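/- Every nonempty finite set F of triangles in ℝ², such that the intersection of any two triangles of F is a common face of both, contains a ≺-maximal element, i.e., a triangle Δ ∈ F for which there is no Δ' ∈ F with Δ ≺ Δ'. -/

import Mathlib

open Set

noncomputable section

/-- A point of the integer lattice `ℤ² ⊆ ℝ²`. -/
def IsLatticePoint (p : ℝ × ℝ) : Prop := ∃ a b : ℤ, p = ((a : ℝ), (b : ℝ))

/-- A triangle: the convex hull of three affinely independent points of `ℝ²`. -/
def IsTriangle (Δ : Set (ℝ × ℝ)) : Prop :=
  ∃ p q r : ℝ × ℝ, AffineIndependent ℝ ![p, q, r] ∧ Δ = convexHull ℝ {p, q, r}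

/-- `F` is a face of the triangle `Δ`: the empty set, a vertex, an edge,
or the whole triangle. -/
def IsFaceOf (F Δ : Set (ℝ × ℝ)) : Prop :=
  ∃ p q r : ℝ × ℝ, AffineIndependent ℝ ![p, q, r] ∧ Δ = convexHull ℝ {p, q, r} ∧
    (F = ∅ ∨ F = {p} ∨ F = {q} ∨ F = {r} ∨
     F = segment ℝ p q ∨ F = segment ℝ q r ∨ F = segment ℝ p r ∨ F = Δ)

/-- The determinant of the two edge vectors of the triangle `pqr` emanating
from `p`; its absolute value is twice the Euclidean area of the triangle. -/
def triDet (p q r : ℝ × ℝ) : ℝ :=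
  (q.1 - p.1) * (r.2 - p.2) - (q.2 - p.2) * (r.1 - p.1)

/-- A unimodular triangle: a lattice triangle of area `1/2`. -/
def IsUnimodularTriangle (Δ : Set (ℝ × ℝ)) : Prop :=
  ∃ p q r : ℝ × ℝ, IsLatticePoint p ∧ IsLatticePoint q ∧ IsLatticePoint r ∧
    AffineIndependent ℝ ![p, q, r] ∧ Δ = convexHull ℝ {p, q, r} ∧
    |triDet p q r| = 1

/-- `T` is a unimodular triangulation of the region `P`. -/
def IsUnimodularTriangulation (P : Set (ℝ × ℝ)) (T : Set (Set (ℝ × ℝ))) : Prop :=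
  T.Finite ∧ (∀ Δ ∈ T, IsUnimodularTriangle Δ ∧ Δ ⊆ P) ∧ ⋃₀ T = P ∧
  ∀ Δ₁ ∈ T, ∀ Δ₂ ∈ T, IsFaceOf (Δ₁ ∩ Δ₂) Δ₁ ∧ IsFaceOf (Δ₁ ∩ Δ₂) Δ₂

/-- The number of unimodular triangulations of the region `P`. -/
def numTriangulations (P : Set (ℝ × ℝ)) : ℕ :=
  Set.ncard {T | IsUnimodularTriangulation P T}

/-- `f m n` is the number of unimodular triangulations of `[0,m] × [0,n]`. -/
def f (m n : ℕ) : ℕ :=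
  numTriangulations (Set.Icc (0, 0) ((m : ℝ), (n : ℝ)))

/-- `Δ₂` lies above `Δ₁` (written `Δ₁ ≺ Δ₂`). -/
def LiesAbove (Δ₁ Δ₂ : Set (ℝ × ℝ)) : Prop :=
  ∃ x y₁ y₂ : ℝ, (x, y₁) ∈ Δ₁ \ Δ₂ ∧ (x, y₂) ∈ Δ₂ \ Δ₁ ∧ y₁ < y₂

/-- If some point of `B` lies above some point of `A` outside the common part, and the common part
is extreme in `A`, then `A` is weakly below `B` on every vertical line. -/
theorem LiesAbove.le {A B : Set (ℝ × ℝ)} (h : LiesAbove A B) (hA : Convex ℝ A)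
    (hB : Convex ℝ B) (hAB : IsExtreme ℝ A (A ∩ B)) {x a b : ℝ} (ha : (x, a) ∈ A)
    (hb : (x, b) ∈ B) : a ≤ b := by
  obtain ⟨x₀, y₁, y₂, h₁, h₂, hlt⟩ := h
  by_contra! hba
  have hd : 0 < (y₂ - y₁) + (a - b) := by linarith
  set t := (y₂ - y₁) / ((y₂ - y₁) + (a - b)) with ht
  set s := (a - b) / ((y₂ - y₁) + (a - b)) with hs
  have ht0 : 0 < t := div_pos (by linarith) hd
  have hs0 : 0 < s := div_pos (by linarith) hd
  have hst : s + t = 1 := by rw [hs, ht]; field_simp; ring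
  have hcross : s * (y₂ - y₁) = t * (a - b) := by rw [hs, ht]; field_simp
  have hz : s • (x₀, y₁) + t • (x, a) = s • (x₀, y₂) + t • (x, b) := by
    ext
    · simp
    · simp; linarith
  have hzA : s • (x₀, y₁) + t • (x, a) ∈ A := hA h₁.1 ha hs0.le ht0.le hst
  have hzB : s • (x₀, y₁) + t • (x, a) ∈ B := by
    rw [hz]; exact hB h₂.1 hb hs0.le ht0.le hst
  exact h₁.2 (hAB.left_mem_of_mem_openSegment h₁.1 ha ⟨hzA, hzB⟩
    ⟨s, t, hs0, ht0, hst, rfl⟩).2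

theorem Convex.exists_mem_vertical_line {A : Set (ℝ × ℝ)} (hA : Convex ℝ A) {p q : ℝ × ℝ}
    (hp : p ∈ A) (hq : q ∈ A) {x : ℝ} (hpx : p.1 ≤ x) (hxq : x ≤ q.1) : ∃ y, (x, y) ∈ A := by
  have h := (hA.linear_image (LinearMap.fst ℝ ℝ ℝ)).ordConnected.out
    (mem_image_of_mem _ hp) (mem_image_of_mem _ hq) ⟨hpx, hxq⟩
  obtain ⟨⟨x', y⟩, hz, rfl⟩ := h
  exact ⟨y, hz⟩

theorem exists_lt_of_mem_interior {A : Set (ℝ × ℝ)} {x y : ℝ} (h : (x, y) ∈ interior A) :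
    ∃ y', y < y' ∧ (x, y') ∈ A := by
  have hc : Continuous fun z : ℝ => (x, z) := by fun_prop
  have hn : (fun z : ℝ => (x, z)) ⁻¹' interior A ∈ nhdsWithin y (Ioi y) :=
    mem_nhdsWithin_of_mem_nhds ((isOpen_interior.preimage hc).mem_nhds h)
  obtain ⟨z, hz, hyz⟩ := (Filter.inter_mem hn self_mem_nhdsWithin |> Filter.nonempty_of_mem)
  exact ⟨z, hyz, interior_subset hz⟩

/-- Just left of its rightmost abscissa, a planar convex set with nonempty interior has
nondegenerate vertical slices. -/
theorem Convex.exists_nondegenerate_slice {B : Set (ℝ × ℝ)} (hB : Convex ℝ B)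
    (hint : (interior B).Nonempty) {m : ℝ × ℝ} (hm : m ∈ B) (hmax : ∀ p ∈ B, p.1 ≤ m.1) {u : ℝ}
    (hu : u < m.1) : ∃ x y y', u < x ∧ x < m.1 ∧ y < y' ∧ (x, y) ∈ B ∧ (x, y') ∈ B := by
  obtain ⟨i, hi⟩ := hint
  have him : i.1 < m.1 := by
    have hc : Continuous fun z : ℝ => (z, i.2) := by fun_prop
    have hn : (fun z : ℝ => (z, i.2)) ⁻¹' interior B ∈ nhdsWithin i.1 (Ioi i.1) :=
      mem_nhdsWithin_of_mem_nhds ((isOpen_interior.preimage hc).mem_nhds hi)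
    obtain ⟨z, hz, hiz⟩ := (Filter.inter_mem hn self_mem_nhdsWithin |> Filter.nonempty_of_mem)
    exact lt_of_lt_of_le hiz (hmax _ (interior_subset hz))
  obtain ⟨x, hx, hxm⟩ := exists_between (max_lt hu him)
  obtain ⟨hux, hix⟩ := max_lt_iff.1 hx
  have hd : 0 < m.1 - i.1 := by linarith
  have hseg : AffineMap.lineMap i m ((x - i.1) / (m.1 - i.1)) ∈ interior B := by
    refine hB.openSegment_interior_self_subset_interior hi hm ?_
    rw [openSegment_eq_image_lineMap]
    refine mem_image_of_mem _ ⟨div_pos (by linarith) hd, (div_lt_one hd).2 (by linarith)⟩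
  have hfst : (AffineMap.lineMap i m ((x - i.1) / (m.1 - i.1)) : ℝ × ℝ).1 = x := by
    simp [AffineMap.lineMap_apply]
    field_simp
    ring
  generalize AffineMap.lineMap i m ((x - i.1) / (m.1 - i.1)) = w at hseg hfst
  obtain ⟨x', y⟩ := w
  obtain rfl : x' = x := hfst
  obtain ⟨y', hy, hy'⟩ := exists_lt_of_mem_interior hseg
  exact ⟨x', y, y', hux, hxm, hy, interior_subset hseg, hy'⟩

/-- The relation `≺` is transitive through a set whose rightmost abscissa is the least one. -/
theorem LiesAbove.trans_of_rightmost {A B C : Set (ℝ × ℝ)} (hA : Convex ℝ A) (hB : Convex ℝ B)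
    (hC : Convex ℝ C) (hAB : IsExtreme ℝ A (A ∩ B)) (hBC : IsExtreme ℝ B (B ∩ C))
    (hint : (interior B).Nonempty) {a m c : ℝ × ℝ} (ha : a ∈ A) (hm : m ∈ B) (hc : c ∈ C)
    (hmax : ∀ p ∈ B, p.1 ≤ m.1) (hma : m.1 ≤ a.1) (hmc : m.1 ≤ c.1)
    (h₁ : LiesAbove A B) (h₂ : LiesAbove B C) : LiesAbove A C := by
  have le₁ : ∀ {x y z : ℝ}, (x, y) ∈ A → (x, z) ∈ B → y ≤ z := fun hy hz => h₁.le hA hB hAB hy hz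
  have le₂ : ∀ {x y z : ℝ}, (x, y) ∈ B → (x, z) ∈ C → y ≤ z := fun hy hz => h₂.le hB hC hBC hy hz
  obtain ⟨x₁, y₁, z₁, hy₁, hz₁, hlt₁⟩ := h₁
  obtain ⟨x₂, y₂, z₂, hy₂, hz₂, hlt₂⟩ := h₂
  have hx₁ : x₁ ≤ m.1 := hmax _ hz₁.1
  have hx₂ : x₂ ≤ m.1 := hmax _ hy₂.1
  rcases hx₁.eq_or_lt with rfl | hx₁
  · obtain ⟨z, hz⟩ := hC.exists_mem_vertical_line hz₂.1 hc hx₂ hmc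
    have hle := le₂ hz₁.1 hz
    refine ⟨m.1, y₁, z, ⟨hy₁.1, fun h => ?_⟩, ⟨hz, fun h => ?_⟩, by linarith⟩
    · linarith [le₂ hz₁.1 h]
    · obtain rfl := le_antisymm hle (le₁ h hz₁.1)
      exact hz₁.2 h
  rcases hx₂.eq_or_lt with rfl | hx₂
  · obtain ⟨y, hy⟩ := hA.exists_mem_vertical_line hy₁.1 ha hx₁.le hma
    have hle := le₁ hy hy₂.1
    refine ⟨m.1, y, z₂, ⟨hy, fun h => ?_⟩, ⟨hz₂.1, fun h => ?_⟩, by linarith⟩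
    · obtain rfl := le_antisymm hle (le₂ hy₂.1 h)
      exact hy₂.2 h
    · linarith [le₁ h hy₂.1]
  obtain ⟨x, b, b', hx, hxm, hbb', hb, hb'⟩ :=
    hB.exists_nondegenerate_slice hint hm hmax (max_lt hx₁ hx₂)
  obtain ⟨hx₁x, hx₂x⟩ := max_lt_iff.1 hx
  obtain ⟨y, hy⟩ := hA.exists_mem_vertical_line hy₁.1 ha hx₁x.le (hxm.le.trans hma)
  obtain ⟨z, hz⟩ := hC.exists_mem_vertical_line hz₂.1 hc hx₂x.le (hxm.le.trans hmc)
  have hyb := le₁ hy hb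
  have hbz := le₂ hb' hz
  refine ⟨x, y, z, ⟨hy, fun h => ?_⟩, ⟨hz, fun h => ?_⟩, by linarith⟩
  · linarith [le₂ hb' h]
  · linarith [le₁ h hb]

theorem triDet_ne_zero {p q r : ℝ × ℝ} (h : AffineIndependent ℝ ![p, q, r]) :
    triDet p q r ≠ 0 := by
  intro hD
  rw [affineIndependent_iff_not_collinear_set] at h
  apply h
  unfold triDet at hD
  by_cases hqp : q = p
  · subst hqp
    simpa using collinear_pair ℝ q r
  rw [collinear_iff_of_mem (p₀ := p) (by simp)]
  refine ⟨q - p, ?_⟩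
  have hp : ∃ t : ℝ, p = t • (q - p) +ᵥ p := ⟨0, by simp⟩
  have hq : ∃ t : ℝ, q = t • (q - p) +ᵥ p := ⟨1, by simp⟩
  have hr : ∃ t : ℝ, r = t • (q - p) +ᵥ p := by
    by_cases h1 : q.1 - p.1 = 0
    · have h2 : q.2 - p.2 ≠ 0 := fun h2 => hqp (Prod.ext (by linarith) (by linarith))
      have h3 : r.1 - p.1 = 0 := by
        rw [h1] at hD
        have : (q.2 - p.2) * (r.1 - p.1) = 0 := by linarith
        exact (mul_eq_zero.1 this).resolve_left h2
      refine ⟨(r.2 - p.2) / (q.2 - p.2), ?_⟩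
      ext
      · simp [h1]; linarith
      · simp; field_simp; ring
    · refine ⟨(r.1 - p.1) / (q.1 - p.1), ?_⟩
      ext
      · simp; field_simp; ring
      · simp; field_simp; linarith
  simpa using And.intro hp (And.intro hq hr)

theorem exists_coords_of_mem_convexHull_triple {p q r z : ℝ × ℝ}
    (hz : z ∈ convexHull ℝ {p, q, r}) :
    ∃ a b c : ℝ, 0 ≤ a ∧ 0 ≤ b ∧ 0 ≤ c ∧ a + b + c = 1 ∧ z = a • p + b • q + c • r := by
  rw [convexHull_insert (by simp), convexHull_pair, convexJoin_singleton_left] at hz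
  simp only [mem_iUnion, segment, mem_ofPred_eq] at hz
  obtain ⟨w, ⟨s, t, hs, ht, hst, rfl⟩, u, v, hu, hv, huv, rfl⟩ := hz
  refine ⟨u, v * s, v * t, hu, by positivity, by positivity, ?_, ?_⟩
  · rw [add_assoc, ← mul_add, hst, mul_one, huv]
  · simp only [smul_add, smul_smul, add_assoc]

theorem triDet_combination (p q r : ℝ × ℝ) {a b c : ℝ} (h : a + b + c = 1) :
    triDet p q (a • p + b • q + c • r) = c * triDet p q r := by
  obtain rfl : a = 1 - b - c := by linarith
  simp [triDet]
  ring

theorem isExtreme_edge {p q r : ℝ × ℝ} (hD : triDet p q r ≠ 0) :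
    IsExtreme ℝ (convexHull ℝ {p, q, r}) (segment ℝ p q) := by
  refine ⟨segment_subset_convexHull (by simp) (by simp), ?_⟩
  rintro x hx y hy z hz ⟨s, t, hs, ht, hst, rfl⟩
  obtain ⟨a, b, c, ha, hb, hc, habc, rfl⟩ := exists_coords_of_mem_convexHull_triple hx
  obtain ⟨a', b', c', ha', hb', hc', habc', rfl⟩ := exists_coords_of_mem_convexHull_triple hy
  obtain ⟨u, v, hu, hv, huv, hz⟩ := hz
  have h0 := triDet_combination p q r (a := u) (b := v) (c := 0) (by linarith)
  rw [zero_smul, add_zero, hz, zero_mul] at h0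
  have h1 := triDet_combination p q r (a := s * a + t * a') (b := s * b + t * b')
    (c := s * c + t * c') (by linear_combination s * habc + t * habc' + hst)
  have h2 : s • (a • p + b • q + c • r) + t • (a' • p + b' • q + c' • r) =
      (s * a + t * a') • p + (s * b + t * b') • q + (s * c + t * c') • r := by module
  rw [← h2, h0] at h1
  have h3 : s * c + t * c' = 0 := (mul_eq_zero.1 h1.symm).resolve_right hD
  have hc0 : c = 0 := by
    have := mul_nonneg ht.le hc'
    have := mul_nonneg hs.le hc
    exact (mul_eq_zero.1 (by linarith : s * c = 0)).resolve_left hs.ne'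
  exact ⟨a, b, ha, hb, by linarith, by simp [hc0]⟩

theorem isExtreme_vertex {p q r : ℝ × ℝ} (hD : triDet p q r ≠ 0) :
    IsExtreme ℝ (convexHull ℝ {p, q, r}) {p} := by
  have hD' : triDet p r q ≠ 0 := by
    intro h; apply hD; unfold triDet at *; linarith
  have h := (isExtreme_edge hD).inter
    (by simpa only [pair_comm r q] using isExtreme_edge hD')
  convert h using 1
  refine Subset.antisymm (by simp [left_mem_segment]) ?_
  rintro z ⟨⟨a, b, ha, hb, hab, rfl⟩, ⟨s, t, hs, ht, hst, h⟩⟩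
  have h0 := triDet_combination p q r (a := a) (b := b) (c := 0) (by linarith)
  have h1 := triDet_combination p q r (a := s) (b := 0) (c := t) (by linarith)
  simp only [zero_smul, add_zero, zero_mul] at h0 h1
  rw [h, h0] at h1
  have ht0 : t = 0 := (mul_eq_zero.1 h1.symm).resolve_right hD
  obtain rfl : s = 1 := by linarith
  rw [mem_singleton_iff, ← h]
  simp [ht0]

theorem IsFaceOf.isExtreme {F Δ : Set (ℝ × ℝ)} (h : IsFaceOf F Δ) : IsExtreme ℝ Δ F := by
  obtain ⟨p, q, r, hind, rfl, h⟩ := h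
  have hD := triDet_ne_zero hind
  have hrot : triDet q r p ≠ 0 := by
    intro h; apply hD; unfold triDet at *; linarith
  have hrot' : triDet r p q ≠ 0 := by
    intro h; apply hD; unfold triDet at *; linarith
  have e₁ : ({p, q, r} : Set (ℝ × ℝ)) = {q, r, p} := by
    rw [insert_comm, pair_comm p r]
  have e₂ : ({p, q, r} : Set (ℝ × ℝ)) = {r, p, q} := by
    rw [pair_comm q r, insert_comm]
  rcases h with rfl | rfl | rfl | rfl | rfl | rfl | rfl | rfl
  · exact ⟨empty_subset _, by simp⟩
  · exact isExtreme_vertex hD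
  · rw [e₁]; exact isExtreme_vertex hrot
  · rw [e₂]; exact isExtreme_vertex hrot'
  · exact isExtreme_edge hD
  · rw [e₁]; exact isExtreme_edge hrot
  · rw [e₂, segment_symm]; exact isExtreme_edge hrot'
  · exact IsExtreme.rfl

theorem IsTriangle.convex {Δ : Set (ℝ × ℝ)} (h : IsTriangle Δ) : Convex ℝ Δ := by
  obtain ⟨p, q, r, -, rfl⟩ := h
  exact convex_convexHull ℝ _

theorem IsTriangle.interior_nonempty {Δ : Set (ℝ × ℝ)} (h : IsTriangle Δ) :
    (interior Δ).Nonempty := by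
  obtain ⟨p, q, r, hind, rfl⟩ := h
  rw [interior_convexHull_nonempty_iff_affineSpan_eq_top]
  have := hind.affineSpan_eq_top_iff_card_eq_finrank_add_one.2 (by simp)
  rw [← this, Matrix.range_cons, Matrix.range_cons_cons_empty, singleton_union]

theorem IsTriangle.exists_rightmost {Δ : Set (ℝ × ℝ)} (h : IsTriangle Δ) :
    ∃ m ∈ Δ, ∀ p ∈ Δ, p.1 ≤ m.1 := by
  have hne := h.interior_nonempty.mono interior_subset
  obtain ⟨p, q, r, -, rfl⟩ := h
  exact ((toFinite {p, q, r}).isCompact_convexHull ℝ).exists_isMaxOn hne continuous_fst.continuousOn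

/-- A finite set has a maximal element for an asymmetric relation which is transitive through
each element that minimizes a given function on the triple involved. -/
theorem Finset.exists_maximal_of_trans_through_min {ι α : Type*} [LinearOrder α] (R : ι → ι → Prop)
    (g : ι → α) (s : Finset ι) (hasymm : ∀ a ∈ s, ∀ b ∈ s, R a b → ¬ R b a)
    (htrans : ∀ a ∈ s, ∀ b ∈ s, ∀ c ∈ s, g b ≤ g a → g b ≤ g c → R a b → R b c → R a c)
    (hne : s.Nonempty) : ∃ a ∈ s, ∀ b ∈ s, ¬ R a b := by
  classical
  induction s using Finset.induction_on_min_value g with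
  | empty => simp at hne
  | insert b s hb hmin ih =>
    by_cases hbmax : ∀ c ∈ insert b s, ¬ R b c
    · exact ⟨b, Finset.mem_insert_self b s, hbmax⟩
    push Not at hbmax
    obtain ⟨c, hc, hbc⟩ := hbmax
    have hbs := Finset.mem_insert_self b s
    have hcs : c ∈ s := by
      refine (Finset.mem_insert.1 hc).resolve_left ?_
      rintro rfl
      exact hasymm _ hbs _ hbs hbc hbc
    have hsub : ∀ {x}, x ∈ s → x ∈ insert b s := fun h => Finset.mem_insert_of_mem h
    obtain ⟨a, ha, hmax⟩ := ih (fun x hx y hy => hasymm x (hsub hx) y (hsub hy))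
      (fun x hx y hy z hz => htrans x (hsub hx) y (hsub hy) z (hsub hz)) ⟨c, hcs⟩
    refine ⟨a, hsub ha, fun d hd had => ?_⟩
    rcases Finset.mem_insert.1 hd with rfl | hd
    · exact hmax c hcs (htrans a (hsub ha) d hbs c hc (hmin a ha) (hmin c hcs) had hbc)
    · exact hmax d hd had

/-- Every nonempty finite family of triangles in `ℝ²`, any two of which
intersect in a common face of both, contains a `≺`-maximal element. -/
theorem exists_maximal_triangle (F : Set (Set (ℝ × ℝ)))
    (hfin : F.Finite) (hne : F.Nonempty)
    (htri : ∀ Δ ∈ F, IsTriangle Δ)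
    (hface : ∀ Δ₁ ∈ F, ∀ Δ₂ ∈ F, Δ₁ ≠ Δ₂ →
      IsFaceOf (Δ₁ ∩ Δ₂) Δ₁ ∧ IsFaceOf (Δ₁ ∩ Δ₂) Δ₂) :
    ∃ Δ ∈ F, ∀ Δ' ∈ F, ¬ LiesAbove Δ Δ' := by
  have hext : ∀ A ∈ F, ∀ B ∈ F, IsExtreme ℝ A (A ∩ B) := by
    intro A hA B hB
    by_cases h : A = B
    · rw [h, inter_self]
    · exact (hface A hA B hB h).1.isExtreme
  choose! m hm hmax using fun A hA => (htri A hA).exists_rightmost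
  have key := Finset.exists_maximal_of_trans_through_min LiesAbove (fun A => (m A).1)
    hfin.toFinset
  simp only [Finite.mem_toFinset, Finite.toFinset_nonempty] at key
  refine key (fun A hA B hB hAB hBA => ?_) (fun A hA B hB C hC hBA hBC => ?_) hne
  · obtain ⟨x, y, z, hy, hz, hlt⟩ := hAB
    exact hlt.not_ge (hBA.le (htri B hB).convex (htri A hA).convex (hext B hB A hA) hz.1 hy.1)
  · exact LiesAbove.trans_of_rightmost (htri A hA).convex (htri B hB).convex (htri C hC).convex
      (hext A hA B hB) (hext B hB C hC) (htri B hB).interior_nonempty (hm A hA) (hm B hB)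
      (hm C hC) (hmax B hB) hBA hBC
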